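/- For every η > 0 and every x ∈ X with v→(x,t) + v←(x,t) > v* - η, there exists a point x̄ ∈ Γ*_t with ‖x - x̄‖ ≤ √(η/μ); that is, the η-neighborhood O^t_η of the optimal trajectories at time t is contained in the √(η/μ)-ball neighborhood of Γ*_t. -/

import Mathlib

open MeasureTheory Set

noncomputable section

/-- An admissible pair `(y,u)` on the time interval `[t₀,t₁]`: the control `u` is
measurable with values in `U`, the trajectory `y` stays in `X`, and `y` is absolutely
continuous with `y'(s) = f (y s) (u s)` for a.e. `s ∈ [t₀,t₁]` (expressed by the
integral representation). -/
def IsAdmissible {d m : ℕ} (X : Set (EuclideanSpace ℝ (Fin d)))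
    (U : Set (EuclideanSpace ℝ (Fin m)))
    (f : EuclideanSpace ℝ (Fin d) → EuclideanSpace ℝ (Fin m) → EuclideanSpace ℝ (Fin d))
    (t₀ t₁ : ℝ) (y : ℝ → EuclideanSpace ℝ (Fin d))
    (u : ℝ → EuclideanSpace ℝ (Fin m)) : Prop :=
  Measurable u ∧ (∀ s ∈ Icc t₀ t₁, u s ∈ U) ∧ (∀ s ∈ Icc t₀ t₁, y s ∈ X) ∧
    ∀ t ∈ Icc t₀ t₁, y t = y t₀ + ∫ s in t₀..t, f (y s) (u s)

/-- The optimal value `v*` of the finite-horizon problem, as an extended real. -/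
def vStar {d m : ℕ} (X : Set (EuclideanSpace ℝ (Fin d)))
    (U : Set (EuclideanSpace ℝ (Fin m)))
    (f : EuclideanSpace ℝ (Fin d) → EuclideanSpace ℝ (Fin m) → EuclideanSpace ℝ (Fin d))
    (ℓ : EuclideanSpace ℝ (Fin d) → EuclideanSpace ℝ (Fin m) → ℝ)
    (φ₀ φT : EuclideanSpace ℝ (Fin d) → ℝ) (T : ℝ) : EReal :=
  ⨆ (p : (ℝ → EuclideanSpace ℝ (Fin d)) × (ℝ → EuclideanSpace ℝ (Fin m)))
    (_ : IsAdmissible X U f 0 T p.1 p.2),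
      (((∫ s in (0:ℝ)..T, ℓ (p.1 s) (p.2 s)) + φ₀ (p.1 0) + φT (p.1 T) : ℝ) : EReal)

/-- The backward value function `v←(x,t)`. -/
def vBack {d m : ℕ} (X : Set (EuclideanSpace ℝ (Fin d)))
    (U : Set (EuclideanSpace ℝ (Fin m)))
    (f : EuclideanSpace ℝ (Fin d) → EuclideanSpace ℝ (Fin m) → EuclideanSpace ℝ (Fin d))
    (ℓ : EuclideanSpace ℝ (Fin d) → EuclideanSpace ℝ (Fin m) → ℝ)
    (φT : EuclideanSpace ℝ (Fin d) → ℝ) (T : ℝ)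
    (x : EuclideanSpace ℝ (Fin d)) (t : ℝ) : EReal :=
  ⨆ (p : (ℝ → EuclideanSpace ℝ (Fin d)) × (ℝ → EuclideanSpace ℝ (Fin m)))
    (_ : IsAdmissible X U f t T p.1 p.2 ∧ p.1 t = x),
      (((∫ s in t..T, ℓ (p.1 s) (p.2 s)) + φT (p.1 T) : ℝ) : EReal)

/-- The forward value function `v→(x,t)`. -/
def vFor {d m : ℕ} (X : Set (EuclideanSpace ℝ (Fin d)))
    (U : Set (EuclideanSpace ℝ (Fin m)))
    (f : EuclideanSpace ℝ (Fin d) → EuclideanSpace ℝ (Fin m) → EuclideanSpace ℝ (Fin d))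
    (ℓ : EuclideanSpace ℝ (Fin d) → EuclideanSpace ℝ (Fin m) → ℝ)
    (φ₀ : EuclideanSpace ℝ (Fin d) → ℝ)
    (x : EuclideanSpace ℝ (Fin d)) (t : ℝ) : EReal :=
  ⨆ (p : (ℝ → EuclideanSpace ℝ (Fin d)) × (ℝ → EuclideanSpace ℝ (Fin m)))
    (_ : IsAdmissible X U f 0 t p.1 p.2 ∧ p.1 t = x),
      (((∫ s in (0:ℝ)..t, ℓ (p.1 s) (p.2 s)) + φ₀ (p.1 0) : ℝ) : EReal)

section Admissible

variable {d m : ℕ} {X : Set (EuclideanSpace ℝ (Fin d))} {U : Set (EuclideanSpace ℝ (Fin m))}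
  {f : EuclideanSpace ℝ (Fin d) → EuclideanSpace ℝ (Fin m) → EuclideanSpace ℝ (Fin d)}
  {t₀ t₁ : ℝ} {y : ℝ → EuclideanSpace ℝ (Fin d)} {u : ℝ → EuclideanSpace ℝ (Fin m)}

/-- A bounded function is interval integrable as soon as it is a.e. strongly measurable. -/
theorem intervalIntegrable_of_norm_le {E : Type*} [NormedAddCommGroup E] {F : ℝ → E} {a b C : ℝ}
    (hab : a ≤ b) (hF : AEStronglyMeasurable F (volume.restrict (Ioc a b)))
    (hC : ∀ s, ‖F s‖ ≤ C) : IntervalIntegrable F volume a b := by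
  rw [intervalIntegrable_iff_integrableOn_Ioc_of_le hab]
  exact Integrable.of_bound hF C (Filter.Eventually.of_forall hC)

/-- The velocity along an admissible pair is integrable: on a maximal initial segment by
continuation, and beyond it because the trajectory would be constant there. -/
theorem IsAdmissible.intervalIntegrable_dynamics (hy : IsAdmissible X U f t₀ t₁ y u)
    (h01 : t₀ ≤ t₁) (hfc : Continuous fun p : _ × _ => f p.1 p.2)
    (hfb : ∃ C, ∀ x u, ‖f x u‖ ≤ C) :
    IntervalIntegrable (fun s => f (y s) (u s)) volume t₀ t₁ := by
  obtain ⟨hu, -, -, hint⟩ := hy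
  obtain ⟨C, hC⟩ := hfb
  set F := fun s => f (y s) (u s) with hF
  have hFC : ∀ s, ‖F s‖ ≤ C := fun s => hC _ _
  set S := {s | s ∈ Icc t₀ t₁ ∧ IntervalIntegrable F volume t₀ s}
  have hS0 : t₀ ∈ S := ⟨left_mem_Icc.2 h01, IntervalIntegrable.refl⟩
  have hSb : BddAbove S := ⟨t₁, fun s hs => hs.1.2⟩
  obtain ⟨s, -, hs, hsS⟩ := exists_seq_tendsto_sSup ⟨t₀, hS0⟩ hSb
  set τ := sSup S
  have h0τ : t₀ ≤ τ := le_csSup hSb hS0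
  have hτ1 : τ ≤ t₁ := csSup_le ⟨t₀, hS0⟩ fun s hs => hs.1.2
  have hleft : IntervalIntegrable F volume t₀ τ := by
    refine intervalIntegrable_of_norm_le h0τ ?_ hFC
    rw [← restrict_Ioo_eq_restrict_Ioc]
    have hun : AEStronglyMeasurable F (volume.restrict (⋃ n, Ioc t₀ (s n))) :=
      aestronglyMeasurable_iUnion_iff.2 fun n => (hsS n).2.1.aestronglyMeasurable
    refine hun.mono_set fun r hr => ?_
    obtain ⟨n, hn⟩ := (hs.eventually (lt_mem_nhds hr.2)).exists
    exact mem_iUnion.2 ⟨n, hr.1, hn.le⟩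
  refine hleft.trans (intervalIntegrable_of_norm_le hτ1 ?_ hFC)
  have hconst : AEStronglyMeasurable (fun s => f (y t₀) (u s)) (volume.restrict (Ioc τ t₁)) :=
    (hfc.comp (Continuous.prodMk_right (y t₀))).comp_aestronglyMeasurable
      hu.aestronglyMeasurable
  refine hconst.congr ((ae_restrict_iff' measurableSet_Ioc).2 (Filter.Eventually.of_forall ?_))
  intro r hr
  have hr01 : r ∈ Icc t₀ t₁ := ⟨h0τ.trans hr.1.le, hr.2⟩
  have hrS : ¬ IntervalIntegrable F volume t₀ r := fun hi =>
    (le_csSup hSb (show r ∈ S from ⟨hr01, hi⟩)).not_gt hr.1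
  have hyr := hint r hr01
  rw [intervalIntegral.integral_undef hrS, add_zero] at hyr
  simp only [hF, hyr]

theorem IsAdmissible.continuousOn (hy : IsAdmissible X U f t₀ t₁ y u)
    (h01 : t₀ ≤ t₁) (hfc : Continuous fun p : _ × _ => f p.1 p.2)
    (hfb : ∃ C, ∀ x u, ‖f x u‖ ≤ C) : ContinuousOn y (Icc t₀ t₁) := by
  have hi := hy.intervalIntegrable_dynamics h01 hfc hfb
  have hc := intervalIntegral.continuousOn_primitive_interval' hi left_mem_uIcc
  rw [uIcc_of_le h01] at hc
  exact (continuousOn_const.add hc).congr hy.2.2.2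

theorem IsAdmissible.intervalIntegrable_cost (hy : IsAdmissible X U f t₀ t₁ y u)
    (h01 : t₀ ≤ t₁) (hfc : Continuous fun p : _ × _ => f p.1 p.2)
    (hfb : ∃ C, ∀ x u, ‖f x u‖ ≤ C)
    {ℓ : EuclideanSpace ℝ (Fin d) → EuclideanSpace ℝ (Fin m) → ℝ}
    (hℓc : Continuous fun p : _ × _ => ℓ p.1 p.2) (hℓb : ∃ C, ∀ x u, |ℓ x u| ≤ C) :
    IntervalIntegrable (fun s => ℓ (y s) (u s)) volume t₀ t₁ := by
  obtain ⟨C, hC⟩ := hℓb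
  refine intervalIntegrable_of_norm_le h01 ?_ fun s => hC (y s) (u s)
  have hym : AEStronglyMeasurable y (volume.restrict (Ioc t₀ t₁)) :=
    ((hy.continuousOn h01 hfc hfb).mono Ioc_subset_Icc_self).aestronglyMeasurable
      measurableSet_Ioc
  exact hℓc.comp_aestronglyMeasurable (hym.prodMk hy.1.aestronglyMeasurable)

theorem IsAdmissible.restrict_left (hy : IsAdmissible X U f t₀ t₁ y u) {t : ℝ} (ht : t ≤ t₁) :
    IsAdmissible X U f t₀ t y u :=
  have hsub : Icc t₀ t ⊆ Icc t₀ t₁ := Icc_subset_Icc_right ht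
  ⟨hy.1, fun s hs => hy.2.1 s (hsub hs), fun s hs => hy.2.2.1 s (hsub hs),
    fun s hs => hy.2.2.2 s (hsub hs)⟩

theorem IsAdmissible.restrict_right (hy : IsAdmissible X U f t₀ t₁ y u) {t : ℝ}
    (ht : t ∈ Icc t₀ t₁) (hfc : Continuous fun p : _ × _ => f p.1 p.2)
    (hfb : ∃ C, ∀ x u, ‖f x u‖ ≤ C) : IsAdmissible X U f t t₁ y u := by
  have hsub : Icc t t₁ ⊆ Icc t₀ t₁ := Icc_subset_Icc_left ht.1
  refine ⟨hy.1, fun s hs => hy.2.1 s (hsub hs), fun s hs => hy.2.2.1 s (hsub hs), fun s hs => ?_⟩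
  have hi := (hy.restrict_left hs.2).intervalIntegrable_dynamics (ht.1.trans hs.1) hfc hfb
  have ht' : t ∈ uIcc t₀ s := mem_uIcc_of_le ht.1 hs.1
  rw [hy.2.2.2 s (hsub hs), hy.2.2.2 t ht, add_assoc,
    intervalIntegral.integral_add_adjacent_intervals
      (hi.mono_set (uIcc_subset_uIcc_left ht')) (hi.mono_set (uIcc_subset_uIcc_right ht'))]

/-- Integrals along a trajectory concatenated at `t` agree with those of its first piece. -/
theorem integral_concat_left {A B E : Type*} [NormedAddCommGroup E] [NormedSpace ℝ E]
    (F : A → B → E) {y₁ y₂ : ℝ → A} {u₁ u₂ : ℝ → B} {a b t : ℝ} (ha : a ≤ t) (hb : b ≤ t) :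
    ∫ s in a..b, F (if s ≤ t then y₁ s else y₂ s) (if s ≤ t then u₁ s else u₂ s) =
      ∫ s in a..b, F (y₁ s) (u₁ s) := by
  refine intervalIntegral.integral_congr fun s hs => ?_
  have : s ≤ t := hs.2.trans (sup_le ha hb)
  simp only [this, if_true]

/-- Integrals along a trajectory concatenated at `t` agree with those of its second piece. -/
theorem integral_concat_right {A B E : Type*} [NormedAddCommGroup E] [NormedSpace ℝ E]
    (F : A → B → E) {y₁ y₂ : ℝ → A} {u₁ u₂ : ℝ → B} {b t : ℝ} (hb : t ≤ b) :
    ∫ s in t..b, F (if s ≤ t then y₁ s else y₂ s) (if s ≤ t then u₁ s else u₂ s) =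
      ∫ s in t..b, F (y₂ s) (u₂ s) := by
  refine intervalIntegral.integral_congr_ae (Filter.Eventually.of_forall fun s hs => ?_)
  rw [uIoc_of_le hb] at hs
  simp only [hs.1.not_ge, if_false]

theorem intervalIntegrable_concat {A B E : Type*} [NormedAddCommGroup E]
    (F : A → B → E) {y₁ y₂ : ℝ → A} {u₁ u₂ : ℝ → B} {a b t : ℝ} (ha : a ≤ t) (hb : t ≤ b)
    (h₁ : IntervalIntegrable (fun s => F (y₁ s) (u₁ s)) volume a t)
    (h₂ : IntervalIntegrable (fun s => F (y₂ s) (u₂ s)) volume t b) :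
    IntervalIntegrable
        (fun s => F (if s ≤ t then y₁ s else y₂ s) (if s ≤ t then u₁ s else u₂ s)) volume a t ∧
      IntervalIntegrable
        (fun s => F (if s ≤ t then y₁ s else y₂ s) (if s ≤ t then u₁ s else u₂ s)) volume t b := by
  refine ⟨h₁.congr fun s hs => ?_, h₂.congr fun s hs => ?_⟩
  · rw [uIoc_of_le ha] at hs
    simp only [hs.2, if_true]
  · rw [uIoc_of_le hb] at hs
    simp only [hs.1.not_ge, if_false]

theorem IsAdmissible.concat {y₁ y₂ : ℝ → EuclideanSpace ℝ (Fin d)}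
    {u₁ u₂ : ℝ → EuclideanSpace ℝ (Fin m)} {t : ℝ} (ht : t ∈ Icc t₀ t₁)
    (h₁ : IsAdmissible X U f t₀ t y₁ u₁) (h₂ : IsAdmissible X U f t t₁ y₂ u₂)
    (heq : y₁ t = y₂ t) (hfc : Continuous fun p : _ × _ => f p.1 p.2)
    (hfb : ∃ C, ∀ x u, ‖f x u‖ ≤ C) :
    IsAdmissible X U f t₀ t₁ (fun s => if s ≤ t then y₁ s else y₂ s)
      (fun s => if s ≤ t then u₁ s else u₂ s) := by
  refine ⟨Measurable.ite measurableSet_Iic h₁.1 h₂.1, fun s hs => ?_, fun s hs => ?_,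
    fun s hs => ?_⟩
  · by_cases hst : s ≤ t
    · simpa only [hst, if_true] using h₁.2.1 s ⟨hs.1, hst⟩
    · simpa only [hst, if_false] using h₂.2.1 s ⟨(not_le.1 hst).le, hs.2⟩
  · by_cases hst : s ≤ t
    · simpa only [hst, if_true] using h₁.2.2.1 s ⟨hs.1, hst⟩
    · simpa only [hst, if_false] using h₂.2.2.1 s ⟨(not_le.1 hst).le, hs.2⟩
  · by_cases hst : s ≤ t
    · rw [integral_concat_left f ht.1 hst]
      simpa only [hst, ht.1, if_true] using h₁.2.2.2 s ⟨hs.1, hst⟩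
    · have hts : t ≤ s := (not_le.1 hst).le
      have hi := intervalIntegrable_concat f ht.1 hts
        (h₁.intervalIntegrable_dynamics ht.1 hfc hfb)
        ((h₂.restrict_left hs.2).intervalIntegrable_dynamics hts hfc hfb)
      rw [← intervalIntegral.integral_add_adjacent_intervals hi.1 hi.2,
        integral_concat_left f ht.1 le_rfl, integral_concat_right f hts]
      simp only [hst, ht.1, if_true, if_false]
      rw [← add_assoc, ← h₁.2.2.2 t ⟨ht.1, le_rfl⟩, heq]
      exact h₂.2.2.2 s ⟨hts, hs.2⟩

end Admissible

section ValueFunctions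

variable {d m : ℕ} {X : Set (EuclideanSpace ℝ (Fin d))} {U : Set (EuclideanSpace ℝ (Fin m))}
  {f : EuclideanSpace ℝ (Fin d) → EuclideanSpace ℝ (Fin m) → EuclideanSpace ℝ (Fin d)}
  {ℓ : EuclideanSpace ℝ (Fin d) → EuclideanSpace ℝ (Fin m) → ℝ}
  {φ₀ φT : EuclideanSpace ℝ (Fin d) → ℝ} {T t : ℝ}

theorem IsAdmissible.payoff_le_vStar {y : ℝ → EuclideanSpace ℝ (Fin d)}
    {u : ℝ → EuclideanSpace ℝ (Fin m)} (hy : IsAdmissible X U f 0 T y u) :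
    (((∫ s in (0:ℝ)..T, ℓ (y s) (u s)) + φ₀ (y 0) + φT (y T) : ℝ) : EReal) ≤
      vStar X U f ℓ φ₀ φT T :=
  le_iSup₂_of_le (y, u) hy le_rfl

theorem IsAdmissible.payoff_le_vFor {y : ℝ → EuclideanSpace ℝ (Fin d)}
    {u : ℝ → EuclideanSpace ℝ (Fin m)} (hy : IsAdmissible X U f 0 t y u) :
    (((∫ s in (0:ℝ)..t, ℓ (y s) (u s)) + φ₀ (y 0) : ℝ) : EReal) ≤ vFor X U f ℓ φ₀ (y t) t :=
  le_iSup₂_of_le (y, u) ⟨hy, rfl⟩ le_rfl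

theorem IsAdmissible.payoff_le_vBack {y : ℝ → EuclideanSpace ℝ (Fin d)}
    {u : ℝ → EuclideanSpace ℝ (Fin m)} (hy : IsAdmissible X U f t T y u) :
    (((∫ s in t..T, ℓ (y s) (u s)) + φT (y T) : ℝ) : EReal) ≤ vBack X U f ℓ φT T (y t) t :=
  le_iSup₂_of_le (y, u) ⟨hy, rfl⟩ le_rfl

/-- The forward and backward values at a point sum to at most the optimal value. -/
theorem vFor_add_vBack_le (ht : t ∈ Icc 0 T)
    (hfc : Continuous fun p : _ × _ => f p.1 p.2) (hfb : ∃ C, ∀ x u, ‖f x u‖ ≤ C)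
    (hℓc : Continuous fun p : _ × _ => ℓ p.1 p.2) (hℓb : ∃ C, ∀ x u, |ℓ x u| ≤ C)
    {x : EuclideanSpace ℝ (Fin d)} {a b r : ℝ}
    (ha : vFor X U f ℓ φ₀ x t = (a : EReal)) (hb : vBack X U f ℓ φT T x t = (b : EReal))
    (hr : vStar X U f ℓ φ₀ φT T = (r : EReal)) : a + b ≤ r := by
  suffices hle : vFor X U f ℓ φ₀ x t ≤ ((r - b : ℝ) : EReal) by
    rw [ha, EReal.coe_le_coe_iff] at hle
    linarith
  refine iSup₂_le fun p hp => EReal.coe_le_coe_iff.2 ?_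
  set J := (∫ s in (0:ℝ)..t, ℓ (p.1 s) (p.2 s)) + φ₀ (p.1 0)
  suffices hle : vBack X U f ℓ φT T x t ≤ ((r - J : ℝ) : EReal) by
    rw [hb, EReal.coe_le_coe_iff] at hle
    linarith
  refine iSup₂_le fun q hq => EReal.coe_le_coe_iff.2 ?_
  have hadm := hp.1.concat ht hq.1 (hp.2.trans hq.2.symm) hfc hfb
  have hi := intervalIntegrable_concat ℓ ht.1 ht.2
    (hp.1.intervalIntegrable_cost ht.1 hfc hfb hℓc hℓb)
    (hq.1.intervalIntegrable_cost ht.2 hfc hfb hℓc hℓb)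
  have hle := hadm.payoff_le_vStar (ℓ := ℓ) (φ₀ := φ₀) (φT := φT)
  have hend : (if T ≤ t then p.1 T else q.1 T) = q.1 T := by
    split_ifs with h
    · rw [← le_antisymm ht.2 h, hp.2, hq.2]
    · rfl
  rw [hr, EReal.coe_le_coe_iff,
    ← intervalIntegral.integral_add_adjacent_intervals hi.1 hi.2,
    integral_concat_left ℓ ht.1 le_rfl, integral_concat_right ℓ ht.2] at hle
  simp only [ht.1, if_true, hend] at hle
  linarith

/-- The payoff of an admissible pair is at most the sum of the two values along it. -/
theorem IsAdmissible.payoff_le_vFor_add_vBack {y : ℝ → EuclideanSpace ℝ (Fin d)}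
    {u : ℝ → EuclideanSpace ℝ (Fin m)} (hy : IsAdmissible X U f 0 T y u) (ht : t ∈ Icc 0 T)
    (hfc : Continuous fun p : _ × _ => f p.1 p.2) (hfb : ∃ C, ∀ x u, ‖f x u‖ ≤ C)
    (hℓc : Continuous fun p : _ × _ => ℓ p.1 p.2) (hℓb : ∃ C, ∀ x u, |ℓ x u| ≤ C) {a b : ℝ}
    (ha : vFor X U f ℓ φ₀ (y t) t = (a : EReal))
    (hb : vBack X U f ℓ φT T (y t) t = (b : EReal)) :
    (∫ s in (0:ℝ)..T, ℓ (y s) (u s)) + φ₀ (y 0) + φT (y T) ≤ a + b := by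
  have h₁ := hy.restrict_left ht.2
  have h₂ := hy.restrict_right ht hfc hfb
  have hle₁ := h₁.payoff_le_vFor (ℓ := ℓ) (φ₀ := φ₀)
  have hle₂ := h₂.payoff_le_vBack (ℓ := ℓ) (φT := φT)
  rw [ha, EReal.coe_le_coe_iff] at hle₁
  rw [hb, EReal.coe_le_coe_iff] at hle₂
  rw [← intervalIntegral.integral_add_adjacent_intervals
    (h₁.intervalIntegrable_cost ht.1 hfc hfb hℓc hℓb)
    (h₂.intervalIntegrable_cost ht.2 hfc hfb hℓc hℓb)]
  linarith

end ValueFunctions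

/-- A strongly concave function falls off quadratically from its maximum. -/
theorem StrongConcaveOn.half_mul_sq_le_sub {E : Type*} [NormedAddCommGroup E]
    [NormedSpace ℝ E] {s : Set E} {F : E → ℝ} {c : ℝ} (hF : StrongConcaveOn s c F)
    {x z : E} (hx : x ∈ s) (hz : z ∈ s) (hmax : ∀ w ∈ s, F w ≤ F z) :
    c / 2 * ‖x - z‖ ^ 2 ≤ F z - F x := by
  have key : ∀ a ∈ Ioo (0 : ℝ) 1, (1 - a) * (c / 2 * ‖x - z‖ ^ 2) ≤ F z - F x := by
    intro a ha
    have hb : 0 ≤ 1 - a := by linarith [ha.2]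
    have h₁ := hF.2 hx hz ha.1.le hb (by ring)
    have h₂ := hmax _ (hF.1 hx hz ha.1.le hb (by ring))
    simp only [smul_eq_mul] at h₁
    refine le_of_mul_le_mul_left ?_ ha.1
    linarith
  have hlim : Filter.Tendsto (fun a : ℝ => (1 - a) * (c / 2 * ‖x - z‖ ^ 2))
      (nhdsWithin 0 (Ioi 0)) (nhds ((1 - 0) * (c / 2 * ‖x - z‖ ^ 2))) :=
    (Continuous.tendsto (by fun_prop) 0).mono_left nhdsWithin_le_nhds
  rw [sub_zero, one_mul] at hlim
  exact le_of_tendsto hlim (Filter.eventually_of_mem (Ioo_mem_nhdsGT one_pos) key)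

/-- Propositions 5.1 and 5.4: under strong concavity of the two value functions at time
`t`, every point of the `η`-neighborhood `O^t_η` is within distance `√(η/μ)` of the set
`Γ*_t` of points of optimal trajectories at time `t`. -/
theorem neighborhood_close_to_optimal_trajectories {d m : ℕ}
    (T : ℝ) (hT : 0 < T)
    (X : Set (EuclideanSpace ℝ (Fin d))) (hX : Bornology.IsBounded X)
    (U : Set (EuclideanSpace ℝ (Fin m)))
    (ℓ : EuclideanSpace ℝ (Fin d) → EuclideanSpace ℝ (Fin m) → ℝ)
    (hℓc : Continuous fun p : EuclideanSpace ℝ (Fin d) × EuclideanSpace ℝ (Fin m) => ℓ p.1 p.2)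
    (hℓb : ∃ C, ∀ x u, |ℓ x u| ≤ C)
    (f : EuclideanSpace ℝ (Fin d) → EuclideanSpace ℝ (Fin m) → EuclideanSpace ℝ (Fin d))
    (hfc : Continuous fun p : EuclideanSpace ℝ (Fin d) × EuclideanSpace ℝ (Fin m) => f p.1 p.2)
    (hfb : ∃ C, ∀ x u, ‖f x u‖ ≤ C)
    (φ₀ φT : EuclideanSpace ℝ (Fin d) → ℝ)
    (hφ₀c : Continuous φ₀) (hφ₀b : ∃ C, ∀ x, |φ₀ x| ≤ C)
    (hφTc : Continuous φT) (hφTb : ∃ C, ∀ x, |φT x| ≤ C)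
    (hXc : Convex ℝ X)
    (hex : ∃ xs us, IsAdmissible X U f 0 T xs us ∧
      (((∫ s in (0:ℝ)..T, ℓ (xs s) (us s)) + φ₀ (xs 0) + φT (xs T) : ℝ) : EReal)
        = vStar X U f ℓ φ₀ φT T)
    (hfin : ∃ r : ℝ, vStar X U f ℓ φ₀ φT T = (r : EReal))
    (t : ℝ) (ht : t ∈ Icc 0 T) (μ : ℝ) (hμ : 0 < μ)
    (g h : EuclideanSpace ℝ (Fin d) → ℝ)
    (hg : ∀ x ∈ X, vFor X U f ℓ φ₀ x t = ((g x : ℝ) : EReal))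
    (hh : ∀ x ∈ X, vBack X U f ℓ φT T x t = ((h x : ℝ) : EReal))
    (hgconc : ConcaveOn ℝ X fun x => g x + (μ / 2) * ‖x‖ ^ 2)
    (hhconc : ConcaveOn ℝ X fun x => h x + (μ / 2) * ‖x‖ ^ 2) :
    ∀ η > (0:ℝ), ∀ x ∈ X,
      vFor X U f ℓ φ₀ x t + vBack X U f ℓ φT T x t >
        vStar X U f ℓ φ₀ φT T - (η : EReal) →
      ∃ xb : EuclideanSpace ℝ (Fin d),
        (∃ ys us, IsAdmissible X U f 0 T ys us ∧
          (((∫ s in (0:ℝ)..T, ℓ (ys s) (us s)) + φ₀ (ys 0) + φT (ys T) : ℝ) : EReal)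
            = vStar X U f ℓ φ₀ φT T ∧ ys t = xb) ∧
        ‖x - xb‖ ≤ Real.sqrt (η / μ) := by
  intro η _ x hx hlt
  obtain ⟨r, hr⟩ := hfin
  obtain ⟨xs, us, hadm, hopt⟩ := hex
  have hxt : xs t ∈ X := hadm.2.2.1 t ht
  refine ⟨xs t, ⟨xs, us, hadm, hopt, rfl⟩, ?_⟩
  have hle : ∀ z ∈ X, g z + h z ≤ r := fun z hz =>
    vFor_add_vBack_le ht hfc hfb hℓc hℓb (hg z hz) (hh z hz) hr
  have hge := hadm.payoff_le_vFor_add_vBack ht hfc hfb hℓc hℓb (hg _ hxt) (hh _ hxt)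
  rw [hr, EReal.coe_eq_coe_iff] at hopt
  have hconc : StrongConcaveOn X (2 * μ) fun z => g z + h z := by
    rw [strongConcaveOn_iff_convex]
    refine (hgconc.add hhconc).congr fun z _ => ?_
    simp only [Pi.add_apply]
    ring
  have hquad := hconc.half_mul_sq_le_sub hx hxt fun w hw => (hle w hw).trans (hopt ▸ hge)
  rw [hg x hx, hh x hx, hr, ← EReal.coe_add, ← EReal.coe_sub, gt_iff_lt,
    EReal.coe_lt_coe_iff] at hlt
  have hmax := hle _ hxt
  refine Real.le_sqrt_of_sq_le ((le_div_iff₀ hμ).2 ?_)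
  linarith
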